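/- The function τ(θ) = 1 + (4/θ) · ( (1/θ) · ∫₀^θ t/(exp(t)−1) dt − 1 ) takes values in the open interval (−1, 1) for every θ ≠ 0, and its sign agrees with the sign of θ: τ(θ) > 0 for θ > 0 and τ(θ) < 0 for θ < 0. -/

import Mathlib

/-- The integrand `t ↦ t/(exp t − 1)`, extended continuously by `1` at `t = 0`. -/
noncomputable def debyeIntegrand (t : ℝ) : ℝ :=
  if t = 0 then 1 else t / (Real.exp t - 1)

/-- Kendall's rank correlation coefficient of the Frank copula with association
parameter `θ ≠ 0`; for `θ < 0` the integral `∫₀^θ` is the oriented (interval) integral. -/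
noncomputable def frankTau (θ : ℝ) : ℝ :=
  1 + (4 / θ) * ((1 / θ) * (∫ t in (0 : ℝ)..θ, debyeIntegrand t) - 1)

theorem debye_eq (t : ℝ) : debyeIntegrand t = (dslope Real.exp 0 t)⁻¹ := by
  unfold debyeIntegrand
  split_ifs with h
  · subst h; simp
  · rw [dslope_of_ne _ h, slope_def_field]; simp

theorem debye_cont : Continuous debyeIntegrand := by
  have h0 : debyeIntegrand = fun t => (dslope Real.exp 0 t)⁻¹ := funext debye_eq
  rw [h0]
  refine Continuous.inv₀ ?_ ?_
  · rw [continuous_iff_continuousAt]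
    intro x
    by_cases hx : x = 0
    · subst hx
      exact continuousAt_dslope_same.2 Real.differentiableAt_exp
    · exact (continuousAt_dslope_of_ne hx).2 Real.continuous_exp.continuousAt
  · intro t
    by_cases h : t = 0
    · subst h; simp
    · rw [dslope_of_ne _ h, slope_def_field]
      simp [sub_eq_zero, h]

theorem debye_lt (t : ℝ) (ht : 0 < t) : debyeIntegrand t < 1 := by
  have := Real.add_one_lt_exp ht.ne'
  rw [debyeIntegrand, if_neg ht.ne', div_lt_one (by linarith)]
  linarith

theorem debye_gt (t : ℝ) (ht : 0 < t) : 1 - t / 2 < debyeIntegrand t := by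
  have h1 := Real.add_one_lt_exp ht.ne'
  rw [debyeIntegrand, if_neg ht.ne', lt_div_iff₀ (by linarith)]
  have hm : StrictMonoOn (fun x : ℝ => x + 2 + (x - 2) * Real.exp x) (Set.Ici 0) := by
    refine strictMonoOn_of_deriv_pos (convex_Ici 0) (by fun_prop) ?_
    intro x hx
    rw [interior_Ici] at hx
    have hx : 0 < x := hx
    have hd : HasDerivAt (fun x : ℝ => x + 2 + (x - 2) * Real.exp x)
        (1 + (1 * Real.exp x + (x - 2) * Real.exp x)) x :=
      ((hasDerivAt_id x).add_const 2).add
        (((hasDerivAt_id x).sub_const 2).mul (Real.hasDerivAt_exp x))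
    rw [hd.deriv]
    have h2 := Real.add_one_lt_exp (neg_ne_zero.2 hx.ne')
    have h3 : Real.exp (-x) * Real.exp x = 1 := by rw [← Real.exp_add]; simp
    nlinarith [mul_lt_mul_of_pos_right h2 (Real.exp_pos x)]
  have := hm (Set.mem_Ici.2 le_rfl) (Set.mem_Ici.2 ht.le) ht
  simp at this
  nlinarith

theorem debye_neg (t : ℝ) : debyeIntegrand (-t) = debyeIntegrand t + t := by
  unfold debyeIntegrand
  by_cases h : t = 0
  · subst h; simp
  · have h1 : Real.exp t - 1 ≠ 0 := by simp [sub_eq_zero, h]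
    have h2 : 1 - Real.exp t ≠ 0 := by
      intro h'; apply h1; linarith
    have h3 := (Real.exp_pos t).ne'
    rw [if_neg h, if_neg (neg_ne_zero.2 h), Real.exp_neg]
    have h4 : (Real.exp t)⁻¹ - 1 = -(Real.exp t - 1) / Real.exp t := by field_simp; ring
    rw [h4]
    field_simp
    ring

theorem frankTau_neg (θ : ℝ) (h : θ ≠ 0) : frankTau (-θ) = -frankTau θ := by
  have h1 : (∫ t in (0 : ℝ)..(-θ), debyeIntegrand t)
      = -((∫ t in (0 : ℝ)..θ, debyeIntegrand t) + θ ^ 2 / 2) := by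
    have h2 := intervalIntegral.integral_comp_neg (a := 0) (b := θ) debyeIntegrand
    rw [neg_zero] at h2
    rw [intervalIntegral.integral_symm, ← h2]
    simp_rw [debye_neg]
    rw [intervalIntegral.integral_add (debye_cont.intervalIntegrable _ _)
      (continuous_id'.intervalIntegrable _ _)]
    simp
  unfold frankTau
  rw [h1]
  field_simp
  ring

theorem frankTau_pos (θ : ℝ) (h : 0 < θ) : 0 < frankTau θ ∧ frankTau θ < 1 := by
  have hu : (∫ t in (0 : ℝ)..θ, debyeIntegrand t) < ∫ t in (0 : ℝ)..θ, (1 : ℝ) :=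
    intervalIntegral.integral_lt_integral_of_continuousOn_of_le_of_exists_lt h
      debye_cont.continuousOn continuousOn_const
      (fun x hx => (debye_lt x hx.1).le) ⟨θ, ⟨h.le, le_rfl⟩, debye_lt θ h⟩
  have hl : (∫ t in (0 : ℝ)..θ, (1 - t / 2)) < ∫ t in (0 : ℝ)..θ, debyeIntegrand t :=
    intervalIntegral.integral_lt_integral_of_continuousOn_of_le_of_exists_lt h
      (by fun_prop) debye_cont.continuousOn
      (fun x hx => (debye_gt x hx.1).le) ⟨θ, ⟨h.le, le_rfl⟩, debye_gt θ h⟩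
  have he : (∫ t in (0 : ℝ)..θ, (1 - t / 2)) = θ - θ ^ 2 / 4 := by
    rw [intervalIntegral.integral_sub (by simp)
      ((by fun_prop : Continuous fun t : ℝ => t / 2).intervalIntegrable _ _)]
    simp
    ring
  rw [he] at hl
  simp at hu
  unfold frankTau
  generalize (∫ t in (0 : ℝ)..θ, debyeIntegrand t) = I at *
  have e : 1 + (4 / θ) * ((1 / θ) * I - 1) = (θ ^ 2 + 4 * I - 4 * θ) / θ ^ 2 := by
    field_simp
    ring
  rw [e]
  constructor
  · apply div_pos _ (by positivity)
    linarith
  · rw [div_lt_one (by positivity)]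
    linarith

/-- `τ(θ) ∈ (−1,1)` for every `θ ≠ 0`, and the sign of `τ(θ)` agrees with the sign
of `θ`: `τ(θ) > 0` for `θ > 0` and `τ(θ) < 0` for `θ < 0`. -/
theorem frankTau_range_and_sign :
    (∀ θ : ℝ, θ ≠ 0 → frankTau θ ∈ Set.Ioo (-1 : ℝ) 1) ∧
    (∀ θ : ℝ, 0 < θ → 0 < frankTau θ) ∧
    (∀ θ : ℝ, θ < 0 → frankTau θ < 0) := by
  have hn : ∀ θ : ℝ, θ < 0 → -1 < frankTau θ ∧ frankTau θ < 0 := by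
    intro θ h
    have h1 := frankTau_pos (-θ) (by linarith)
    rw [frankTau_neg θ h.ne] at h1
    constructor <;> linarith [h1.1, h1.2]
  refine ⟨?_, fun θ h => (frankTau_pos θ h).1, fun θ h => (hn θ h).2⟩
  intro θ h
  rcases lt_or_gt_of_ne h with h | h
  · exact ⟨(hn θ h).1, by linarith [(hn θ h).2]⟩
  · exact ⟨by linarith [(frankTau_pos θ h).1], (frankTau_pos θ h).2⟩
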